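/- arXiv:1708.09267 — 5 statements merged into one kernel-verified Lean document; each statement's English description precedes it below -/
import Mathlib

section
/- Let m ≥ 1 be an integer, k > 0 a real number, t ∈ ℝ, and α, z ∈ ℂ^m. Set H(z) = Re(Σ_{j=1}^m α_j z̄_j). Then the function y ↦ exp( k [ (it/4) Σ_j (α_j ȳ_j + \overline{α_j} y_j) + Σ_j z_j \overline{(y_j − i t α_j/2)} − (1/2)|y − itα/2|² + Σ_j y_j z̄_j − (1/2)|y|² − |z|² ] ) is integrable on ℂ^m and (k/π)^m ∫_{ℂ^m} exp( k [ (it/4) Σ_j (α_j ȳ_j + \overline{α_j} y_j) + Σ_j z_j \overline{(y_j − i t α_j/2)} − (1/2)|y − itα/2|² + Σ_j y_j z̄_j − (1/2)|y|² − |z|² ] ) dL(y) = exp( i k t H(z) − k t² |α|²/8 ). -/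
open MeasureTheory ComplexConjugate

/-- Hermitian pairing `z·w̄ = Σ_j z_j conj(w_j)` on `ℂ^m`. -/
noncomputable def dotc {m : ℕ} (z w : Fin m → ℂ) : ℂ := ∑ j, z j * conj (w j)

/-- `|z|² = Σ_j |z_j|²` on `ℂ^m`. -/
noncomputable def nsq {m : ℕ} (z : Fin m → ℂ) : ℝ := ∑ j, Complex.normSq (z j)

/-- The phase `k[(it/4) Σ_j (α_j ȳ_j + ᾱ_j y_j) + Σ_j z_j (y_j − itα_j/2)‾
− (1/2)|y − itα/2|² + Σ_j y_j z̄_j − (1/2)|y|² − |z|²]` of the parametrix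
composition formula for the linear-Hamiltonian propagator. -/
noncomputable def propPhase (m : ℕ) (k t : ℝ) (α z y : Fin m → ℂ) : ℂ :=
  (k : ℂ) * (Complex.I * (t : ℂ) / 4 * ∑ j, (α j * conj (y j) + conj (α j) * y j)
    + ∑ j, z j * conj (y j - Complex.I * (t : ℂ) * α j / 2)
    - (1 / 2 : ℂ) * ((nsq (fun j => y j - Complex.I * (t : ℂ) * α j / 2) : ℝ) : ℂ)
    + ∑ j, y j * conj (z j)
    - (1 / 2 : ℂ) * ((nsq y : ℝ) : ℂ) - ((nsq z : ℝ) : ℂ))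

theorem integrable_prod_cexp_quadratic {k : ℝ} (hk : 0 < k) (c d : ℂ) :
    Integrable (fun p : ℝ × ℝ =>
      Complex.exp (-k * (p.1 : ℂ) ^ 2 + c * p.1 + 0) *
        Complex.exp (-k * (p.2 : ℂ) ^ 2 + d * p.2 + 0)) := by
  have hb : (-(k : ℂ)).re < 0 := by simpa using hk
  exact (integrable_cexp_quadratic' hb c 0).mul_prod (integrable_cexp_quadratic' hb d 0)

theorem integral_prod_cexp_quadratic {k : ℝ} (hk : 0 < k) (c d : ℂ) :
    ∫ p : ℝ × ℝ, Complex.exp (-k * (p.1 : ℂ) ^ 2 + c * p.1 + 0) *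
        Complex.exp (-k * (p.2 : ℂ) ^ 2 + d * p.2 + 0) =
      (Real.pi / k : ℂ) * Complex.exp ((c ^ 2 + d ^ 2) / (4 * k)) := by
  have hb : (-(k : ℂ)).re < 0 := by simpa using hk
  have hk' : (k : ℂ) ≠ 0 := by exact_mod_cast hk.ne'
  have hpi : (Real.pi / k : ℂ) ≠ 0 :=
    div_ne_zero (by exact_mod_cast Real.pi_ne_zero) hk'
  have hsqrt : (Real.pi / k : ℂ) ^ (1 / 2 : ℂ) * (Real.pi / k : ℂ) ^ (1 / 2 : ℂ) =
      Real.pi / k := by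
    rw [← Complex.cpow_add _ _ hpi]
    norm_num
  rw [Measure.volume_eq_prod, integral_prod_mul
      (fun x : ℝ => Complex.exp (-k * (x : ℂ) ^ 2 + c * x + 0))
      (fun x : ℝ => Complex.exp (-k * (x : ℂ) ^ 2 + d * x + 0)),
    integral_cexp_quadratic hb, integral_cexp_quadratic hb, neg_neg, mul_mul_mul_comm, hsqrt,
    ← Complex.exp_add]
  congr 2
  field_simp
  ring

theorem cexp_neg_normSq_add_eq (k : ℝ) (a b w : ℂ) :
    Complex.exp (k * (-(Complex.normSq w : ℂ) + a * conj w + b * w)) =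
      Complex.exp (-k * (w.re : ℂ) ^ 2 + k * (a + b) * w.re + 0) *
        Complex.exp (-k * (w.im : ℂ) ^ 2 + k * (Complex.I * (b - a)) * w.im + 0) := by
  rw [← Complex.exp_add, ← Complex.mul_conj]
  congr 1
  have hw : w = w.re + w.im * Complex.I := (Complex.re_add_im w).symm
  have hc : conj w = w.re - w.im * Complex.I := by
    apply Complex.ext <;> simp
  rw [hc]
  linear_combination (k : ℂ) * (b - (w.re - w.im * Complex.I)) * hw +
    (k : ℂ) * w.im ^ 2 * Complex.I_sq

theorem integrable_cexp_neg_normSq_add {k : ℝ} (hk : 0 < k) (a b : ℂ) :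
    Integrable (fun w : ℂ =>
      Complex.exp (k * (-(Complex.normSq w : ℂ) + a * conj w + b * w))) := by
  simp_rw [cexp_neg_normSq_add_eq]
  exact Complex.volume_preserving_equiv_real_prod.integrable_comp_of_integrable
    (integrable_prod_cexp_quadratic hk (k * (a + b)) (k * (Complex.I * (b - a))))

/-- The Gaussian integral with linear terms in `w` and `conj w` on `ℂ`. -/
theorem integral_cexp_neg_normSq_add {k : ℝ} (hk : 0 < k) (a b : ℂ) :
    ∫ w : ℂ, Complex.exp (k * (-(Complex.normSq w : ℂ) + a * conj w + b * w)) =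
      (Real.pi / k : ℂ) * Complex.exp (k * (a * b)) := by
  have hk' : (k : ℂ) ≠ 0 := by exact_mod_cast hk.ne'
  simp_rw [cexp_neg_normSq_add_eq]
  refine (Complex.volume_preserving_equiv_real_prod.integral_comp
    Complex.measurableEquivRealProd.measurableEmbedding _).trans
    ((integral_prod_cexp_quadratic hk (k * (a + b)) (k * (Complex.I * (b - a)))).trans ?_)
  congr 2
  field_simp
  linear_combination (b - a) ^ 2 * Complex.I_sq

theorem propPhase_eq_sum (m : ℕ) (k t : ℝ) (α z y : Fin m → ℂ) :
    propPhase m k t α z y =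
      (∑ j, (k : ℂ) * (-(Complex.normSq (y j) : ℂ) +
        (Complex.I * t * α j / 2 + z j) * conj (y j) + conj (z j) * y j)) +
      ∑ j, (k : ℂ) * (Complex.I * t / 2 * (z j * conj (α j)) -
        t ^ 2 / 8 * (Complex.normSq (α j) : ℂ) - (Complex.normSq (z j) : ℂ)) := by
  simp only [propPhase, nsq, Complex.ofReal_sum, Finset.mul_sum, ← Finset.sum_add_distrib,
    ← Finset.sum_sub_distrib]
  refine Finset.sum_congr rfl fun j _ => ?_
  simp only [← Complex.mul_conj, map_sub, map_mul, map_div₀, Complex.conj_I,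
    Complex.conj_ofReal, map_ofNat]
  linear_combination (k : ℂ) * t ^ 2 / 8 * α j * conj (α j) * Complex.I_sq

theorem phase_exponent_sum (m : ℕ) (k t : ℝ) (α z : Fin m → ℂ) :
    (∑ j, (k : ℂ) * ((Complex.I * t * α j / 2 + z j) * conj (z j))) +
      ∑ j, (k : ℂ) * (Complex.I * t / 2 * (z j * conj (α j)) -
        t ^ 2 / 8 * (Complex.normSq (α j) : ℂ) - (Complex.normSq (z j) : ℂ)) =
      Complex.I * k * t * ((dotc α z).re : ℂ) - ((k * t ^ 2 * nsq α / 8 : ℝ) : ℂ) := by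
  simp only [dotc, nsq, Complex.re_sum, Complex.ofReal_sum, Complex.ofReal_div,
    Complex.ofReal_mul, Finset.mul_sum, Finset.sum_div, ← Finset.sum_add_distrib,
    ← Finset.sum_sub_distrib]
  refine Finset.sum_congr rfl fun j _ => ?_
  rw [Complex.re_eq_add_conj]
  simp only [← Complex.mul_conj, map_mul, Complex.conj_conj]
  push_cast
  ring

/-- The on-diagonal propagator of the Toeplitz quantization of the linear Hamiltonian
`H(z) = Re(α·z̄)` in the Bargmann–Fock model: the Gaussian integral
`(k/π)^m ∫ e^{propPhase} dL(y) = e^{iktH(z) − kt²|α|²/8}`. -/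
theorem linear_hamiltonian_propagator_diagonal (m : ℕ) (hm : 1 ≤ m) (k : ℝ) (hk : 0 < k)
    (t : ℝ) (α z : Fin m → ℂ) :
    Integrable (fun y : Fin m → ℂ => Complex.exp (propPhase m k t α z y)) ∧
    ((k / Real.pi : ℝ) ^ m : ℂ) * (∫ y : Fin m → ℂ, Complex.exp (propPhase m k t α z y)) =
      Complex.exp (Complex.I * (k : ℂ) * (t : ℂ) * (((dotc α z).re : ℝ) : ℂ) -
        ((k * t ^ 2 * nsq α / 8 : ℝ) : ℂ)) := by
  have hexp : (fun y : Fin m → ℂ => Complex.exp (propPhase m k t α z y)) = fun y =>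
      (∏ j, Complex.exp (k * (-(Complex.normSq (y j) : ℂ) +
        (Complex.I * t * α j / 2 + z j) * conj (y j) + conj (z j) * y j))) *
      Complex.exp (∑ j, (k : ℂ) * (Complex.I * t / 2 * (z j * conj (α j)) -
        t ^ 2 / 8 * (Complex.normSq (α j) : ℂ) - (Complex.normSq (z j) : ℂ))) := by
    funext y
    rw [propPhase_eq_sum, Complex.exp_add, Complex.exp_sum]
  have hk' : (k : ℂ) ≠ 0 := by exact_mod_cast hk.ne'
  have hpi : (Real.pi : ℂ) ≠ 0 := by exact_mod_cast Real.pi_ne_zero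
  rw [hexp]
  refine ⟨(Integrable.fintype_prod fun j =>
    integrable_cexp_neg_normSq_add hk (Complex.I * t * α j / 2 + z j)
      (conj (z j))).mul_const _, ?_⟩
  rw [integral_mul_const, integral_fintype_prod_volume_eq_prod (fun j (w : ℂ) =>
    Complex.exp (k * (-(Complex.normSq w : ℂ) +
        (Complex.I * t * α j / 2 + z j) * conj w + conj (z j) * w)))]
  simp_rw [integral_cexp_neg_normSq_add hk]
  rw [Finset.prod_mul_distrib, Finset.prod_const, Finset.card_univ, Fintype.card_fin,
    ← Complex.exp_sum, mul_assoc, ← Complex.exp_add, phase_exponent_sum, ← mul_assoc,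
    ← mul_pow, Complex.ofReal_div, div_mul_div_cancel₀ hpi, div_self hk', one_pow, one_mul]
end

section
/- Let m ≥ 1 be an integer, a < 0 a real number, and t ∈ ℝ. Then both the series Σ_{n∈ℤ} m! · ( −a − i(t + 2πn) )^{−(m+1)} and the series Σ_{k=1}^∞ k^m e^{k(a + it)} converge absolutely, and Σ_{n∈ℤ} m! · ( −a − i(t + 2πn) )^{−(m+1)} = Σ_{k=1}^∞ k^m e^{k(a + it)}. -/
/-- Each term of the polar series is a multiple of a term of the Lipschitz series. -/
lemma factorial_mul_zpow_eq_lipschitz_term (m : ℕ) {a t : ℝ} {z : ℂ}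
    (hz : 2 * Real.pi * Complex.I * z = a + Complex.I * t) (n : ℤ) : (m.factorial : ℂ) *
      (-(a : ℂ) - Complex.I * ((t : ℂ) + 2 * (Real.pi : ℂ) * (n : ℂ))) ^ (-((m : ℤ) + 1)) =
      m.factorial / (-2 * Real.pi * Complex.I) ^ (m + 1) * (1 / (z + n) ^ (m + 1)) := by
  have hbase : -(a : ℂ) - Complex.I * ((t : ℂ) + 2 * (Real.pi : ℂ) * (n : ℂ)) =
      -2 * Real.pi * Complex.I * (z + n) := by
    linear_combination hz
  rw [hbase, zpow_neg, ← Nat.cast_succ, zpow_natCast,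
    mul_pow _ (z + n), mul_inv, one_div, div_eq_mul_inv, ← mul_assoc]

lemma add_one_pow_mul_exp_eq_nat_term (m : ℕ) {w w' : ℂ} (hw : w' = w) (k : ℕ) :
    ((k : ℂ) + 1) ^ m * Complex.exp (((k : ℂ) + 1) * w) =
      ((k + 1 : ℕ) : ℂ) ^ m * Complex.exp w' ^ (k + 1) := by
  rw [hw, ← Complex.exp_nat_mul, Nat.cast_succ]

/-- The Lipschitz formula, with the Fourier series starting at index one. -/
lemma tsum_lipschitz_eq_tsum_add_one {m : ℕ} (hm : 1 ≤ m) (z : UpperHalfPlane) :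
    ∑' n : ℤ, m.factorial / (-2 * Real.pi * Complex.I) ^ (m + 1) *
        (1 / ((z : ℂ) + n) ^ (m + 1)) =
      ∑' k : ℕ, ((k + 1 : ℕ) : ℂ) ^ m *
        Complex.exp (2 * Real.pi * Complex.I * z) ^ (k + 1) := by
  have hpow : (-2 * Real.pi * Complex.I : ℂ) ^ (m + 1) ≠ 0 :=
    pow_ne_zero _ (by simp [Real.pi_ne_zero])
  have hfac : (m.factorial : ℂ) ≠ 0 := mod_cast m.factorial_ne_zero
  have hsum : Summable fun k : ℕ ↦
      (k : ℂ) ^ m * Complex.exp (2 * Real.pi * Complex.I * z) ^ k := by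
    simpa using summable_pow_mul_cexp m 1 z
  rw [tsum_mul_left, EisensteinSeries.qExpansion_identity hm, hsum.tsum_eq_zero_add]
  rw [Nat.cast_zero, zero_pow (by lia : m ≠ 0), zero_mul, zero_add, ← mul_assoc,
    div_mul_div_cancel₀ hpow, div_self hfac, one_mul]

/-- Every point of the left half-plane is `2πi` times a point of the upper half-plane. -/
lemma exists_upperHalfPlane_two_pi_I_mul_eq {a : ℝ} (ha : a < 0) (t : ℝ) :
    ∃ z : UpperHalfPlane, 2 * Real.pi * Complex.I * (z : ℂ) = a + Complex.I * t := by
  refine ⟨⟨⟨t / (2 * Real.pi), -a / (2 * Real.pi)⟩, div_pos (neg_pos.2 ha) (by positivity)⟩, ?_⟩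
  apply Complex.ext <;> simp <;> field_simp

/-- The Poisson-summation identity relating the Szegő kernel of the simply connected
Heisenberg group to that of the reduced Heisenberg group: for `a < 0`,
`Σ_{n∈ℤ} m!(−a − i(t + 2πn))^{−(m+1)} = Σ_{k=1}^∞ k^m e^{k(a+it)}`,
both series converging absolutely. -/
theorem heisenberg_poisson_summation (m : ℕ) (hm : 1 ≤ m) (a t : ℝ) (ha : a < 0) :
    Summable (fun n : ℤ => ‖(m.factorial : ℂ) *
      (-(a : ℂ) - Complex.I * ((t : ℂ) + 2 * (Real.pi : ℂ) * (n : ℂ))) ^ (-((m : ℤ) + 1))‖) ∧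
    Summable (fun k : ℕ => ‖((k : ℂ) + 1) ^ m *
      Complex.exp (((k : ℂ) + 1) * ((a : ℂ) + Complex.I * (t : ℂ)))‖) ∧
    (∑' n : ℤ, (m.factorial : ℂ) *
        (-(a : ℂ) - Complex.I * ((t : ℂ) + 2 * (Real.pi : ℂ) * (n : ℂ))) ^ (-((m : ℤ) + 1))) =
      ∑' k : ℕ, ((k : ℂ) + 1) ^ m *
        Complex.exp (((k : ℂ) + 1) * ((a : ℂ) + Complex.I * (t : ℂ))) := by
  obtain ⟨z, hz⟩ := exists_upperHalfPlane_two_pi_I_mul_eq ha t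
  have hleft := factorial_mul_zpow_eq_lipschitz_term m hz
  have hright := add_one_pow_mul_exp_eq_nat_term m hz
  have hsum : Summable fun k : ℕ ↦
      (k : ℂ) ^ m * Complex.exp (2 * Real.pi * Complex.I * z) ^ k := by
    simpa using summable_pow_mul_cexp m 1 z
  have hlip : Summable fun n : ℤ ↦ 1 / ((z : ℂ) + n) ^ (m + 1) := by
    refine (EisensteinSeries.linear_right_summable (z : ℂ) 1 (k := m + 1) (by lia)).congr
      fun n ↦ ?_
    rw [Int.cast_one, one_mul, one_div, ← Nat.cast_succ, zpow_natCast]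
  refine ⟨?_, ?_, ?_⟩
  · exact ((hlip.mul_left _).congr fun n ↦ (hleft n).symm).norm
  · exact (((summable_nat_add_iff 1).2 hsum).congr fun k ↦ (hright k).symm).norm
  · rw [tsum_congr hleft, tsum_congr hright]
    exact tsum_lipschitz_eq_tsum_add_one hm z
end

section
/- Let ε > 0 and r ≥ 0 be real numbers. If r < ε then lim_{k→∞} e^{−kr} Σ_{j=0}^{⌊εk⌋} (kr)^j / j! = 1, and if r > ε then lim_{k→∞} e^{−kr} Σ_{j=0}^{⌊εk⌋} (kr)^j / j! = 0, where the limit is taken over positive integers k. -/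
open Filter

/-- Chernoff bound for the exponential series: the part of the series over the indices on the
side of `y` selected by the sign of `t`. -/
theorem tsum_indicator_pow_div_factorial_le (S : Set ℕ) {x : ℝ} (hx : 0 ≤ x) (t y : ℝ)
    (hS : ∀ j ∈ S, 0 ≤ t * (j - y)) :
    ∑' j, S.indicator (fun j : ℕ => x ^ j / (j.factorial : ℝ)) j ≤
      Real.exp (x * Real.exp t - t * y) := by
  have hsum : HasSum (fun j : ℕ => Real.exp (-(t * y)) *
      ((x * Real.exp t) ^ j / (j.factorial : ℝ))) (Real.exp (x * Real.exp t - t * y)) := by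
    have h := (NormedSpace.expSeries_div_hasSum_exp (x * Real.exp t)).mul_left
      (Real.exp (-(t * y)))
    rwa [← Real.exp_eq_exp_ℝ, ← Real.exp_add, neg_add_eq_sub] at h
  rw [← hsum.tsum_eq]
  refine Summable.tsum_le_tsum (fun j => ?_)
    ((Real.summable_pow_div_factorial x).indicator S) hsum.summable
  refine Set.indicator_apply_le' (fun hj => ?_) fun _ => by positivity
  have h1 : 1 ≤ Real.exp (t * (j - y)) := Real.one_le_exp (hS j hj)
  calc x ^ j / (j.factorial : ℝ)
      ≤ Real.exp (t * (j - y)) * (x ^ j / (j.factorial : ℝ)) :=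
        le_mul_of_one_le_left (by positivity) h1
    _ = Real.exp (-(t * y)) * ((x * Real.exp t) ^ j / (j.factorial : ℝ)) := by
        rw [mul_pow, ← Real.exp_nat_mul, show t * (j - y) = -(t * y) + j * t by ring, Real.exp_add]
        ring

/-- The Chernoff exponent is negative at `t = (ε - r) / (2ε)` as soon as `r ≠ ε`. -/
theorem chernoff_exponent_neg {ε r : ℝ} (hε : 0 < ε) (hr : 0 ≤ r) (hne : r ≠ ε) :
    r * (Real.exp ((ε - r) / (2 * ε)) - 1) - (ε - r) / (2 * ε) * ε < 0 := by
  set t := (ε - r) / (2 * ε) with ht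
  have hεt : 2 * (ε * t) = ε - r := by rw [ht]; field_simp
  have ht0 : t ≠ 0 := by
    intro h
    rw [h] at hεt
    exact hne (by linarith)
  have ht1 : 0 < 1 - t := by
    by_contra! h
    nlinarith
  have hexp : (1 - t) * Real.exp t ≤ 1 := by
    have h := mul_le_mul_of_nonneg_right (Real.one_sub_le_exp_neg t) (Real.exp_pos t).le
    rwa [← Real.exp_add, neg_add_cancel, Real.exp_zero] at h
  have hr' : r = ε - 2 * (ε * t) := by linarith
  have hpos : 0 < ε * t ^ 2 := by positivity
  refine neg_of_mul_neg_right (a := 1 - t) ?_ ht1.le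
  calc (1 - t) * (r * (Real.exp t - 1) - t * ε)
      = r * ((1 - t) * Real.exp t) - r * (1 - t) - (1 - t) * t * ε := by ring
    _ ≤ r * 1 - r * (1 - t) - (1 - t) * t * ε := by gcongr
    _ = -(ε * t ^ 2) := by rw [hr']; ring
    _ < 0 := by linarith

/-- The Poisson mass of sets `S k` lying on the side of `ε * k` away from the mean `k * r`
tends to zero. -/
theorem tendsto_exp_neg_mul_tsum_indicator {ε r : ℝ} (hε : 0 < ε) (hr : 0 ≤ r) (hne : r ≠ ε)
    (S : ℕ → Set ℕ) (hS : ∀ k, ∀ j ∈ S k, 0 ≤ (ε - r) * ((j : ℝ) - ε * k)) :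
    Tendsto (fun k : ℕ => Real.exp (-((k : ℝ) * r)) *
      ∑' j, (S k).indicator (fun j : ℕ => ((k : ℝ) * r) ^ j / (j.factorial : ℝ)) j)
      atTop (nhds 0) := by
  have hneg := chernoff_exponent_neg hε hr hne
  set t := (ε - r) / (2 * ε) with ht
  have hlim : Tendsto (fun k : ℕ => Real.exp ((k : ℝ) * (r * (Real.exp t - 1) - t * ε)))
      atTop (nhds 0) :=
    Real.tendsto_exp_atBot.comp (tendsto_natCast_atTop_atTop.atTop_mul_const_of_neg hneg)
  refine squeeze_zero (fun k => ?_) (fun k => ?_) hlim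
  · exact mul_nonneg (Real.exp_pos _).le
      (tsum_nonneg fun j => Set.indicator_nonneg (fun _ _ => by positivity) j)
  · have h := tsum_indicator_pow_div_factorial_le (S k) (x := k * r) (by positivity) t (ε * k)
      fun j hj => by
        rw [ht, div_mul_eq_mul_div]
        exact div_nonneg (hS k j hj) (by positivity)
    calc _ ≤ Real.exp (-((k : ℝ) * r)) * Real.exp (k * r * Real.exp t - t * (ε * k)) := by gcongr
      _ = _ := by rw [← Real.exp_add]; congr 1; ring

/-- Bulk asymptotics of the partial Bergman density in the Bargmann–Fock model
(law of large numbers for Poisson tails): with `r = |z|²`,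
`e^{−kr} Σ_{j=0}^{⌊εk⌋} (kr)^j/j! → 1` if `r < ε` (allowed region) and `→ 0` if
`r > ε` (forbidden region). -/
theorem bargmannFock_bulk_density (ε r : ℝ) (hε : 0 < ε) (hr : 0 ≤ r) :
    (r < ε → Tendsto (fun k : ℕ =>
      Real.exp (-((k : ℝ) * r)) *
        ∑ j ∈ Finset.range (Nat.floor (ε * (k : ℝ)) + 1), ((k : ℝ) * r) ^ j / (j.factorial : ℝ))
      atTop (nhds 1)) ∧
    (ε < r → Tendsto (fun k : ℕ =>
      Real.exp (-((k : ℝ) * r)) *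
        ∑ j ∈ Finset.range (Nat.floor (ε * (k : ℝ)) + 1), ((k : ℝ) * r) ^ j / (j.factorial : ℝ))
      atTop (nhds 0)) := by
  have hfin (k : ℕ) (n : ℕ) : ∑ j ∈ Finset.range n, ((k : ℝ) * r) ^ j / (j.factorial : ℝ) =
      ∑' j, (Finset.range n : Set ℕ).indicator
        (fun j : ℕ => ((k : ℝ) * r) ^ j / (j.factorial : ℝ)) j :=
    sum_eq_tsum_indicator _ _
  refine ⟨fun h => ?_, fun h => ?_⟩
  · have hlim := (tendsto_exp_neg_mul_tsum_indicator hε hr h.ne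
      (fun k => (Finset.range (Nat.floor (ε * (k : ℝ)) + 1) : Set ℕ)ᶜ) fun k j hj => by
        have hj' : Nat.floor (ε * (k : ℝ)) < j := by simpa using hj
        exact mul_nonneg (sub_nonneg.2 h.le)
          (sub_nonneg.2 ((Nat.floor_lt (by positivity)).1 hj').le)).const_sub 1
    rw [sub_zero] at hlim
    refine hlim.congr fun k => ?_
    have hsum := Real.summable_pow_div_factorial ((k : ℝ) * r)
    have hexp : ∑' j : ℕ, ((k : ℝ) * r) ^ j / (j.factorial : ℝ) = Real.exp (k * r) := by
      rw [Real.exp_eq_exp_ℝ]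
      exact (NormedSpace.expSeries_div_hasSum_exp _).tsum_eq
    have hsplit := (hsum.indicator (Finset.range (Nat.floor (ε * (k : ℝ)) + 1) : Set ℕ)).tsum_add
      (hsum.indicator (Finset.range (Nat.floor (ε * (k : ℝ)) + 1) : Set ℕ)ᶜ)
    simp only [Set.indicator_self_add_compl_apply, hexp] at hsplit
    have hone : Real.exp (-((k : ℝ) * r)) * Real.exp (k * r) = 1 := by
      rw [← Real.exp_add, neg_add_cancel, Real.exp_zero]
    rw [hfin, sub_eq_iff_eq_add, ← mul_add, ← hsplit, hone]
  · simp only [hfin]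
    refine tendsto_exp_neg_mul_tsum_indicator hε hr h.ne' _ fun k j hj => ?_
    have hj' : j ≤ Nat.floor (ε * (k : ℝ)) := by simpa [Nat.lt_succ_iff] using hj
    exact mul_nonneg_of_nonpos_of_nonpos (sub_nonpos.2 h.le)
      (sub_nonpos.2 ((Nat.le_floor_iff (by positivity)).1 hj'))
end

section
/- Let ε > 0 and u ∈ ℝ, and for each positive integer k with 1 + u/√k > 0 set r_k = ε(1 + u k^{−1/2}). Then lim_{k→∞} e^{−k r_k} Σ_{j=0}^{⌊εk⌋} (k r_k)^j / j! = Φ(−u√ε), where Φ(x) = (2π)^{−1/2} ∫_{−∞}^x e^{−t²/2} dt. -/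
open Filter MeasureTheory

/-- The Gaussian error function `Φ(x) = (2π)^{−1/2} ∫_{−∞}^x e^{−t²/2} dt`. -/
noncomputable def gaussErf (x : ℝ) : ℝ :=
  (Real.sqrt (2 * Real.pi))⁻¹ * ∫ t in Set.Iic x, Real.exp (-t ^ 2 / 2)

open ProbabilityTheory
open scoped NNReal Topology

theorem gaussErf_eq_gaussianReal (x : ℝ) :
    gaussErf x = (gaussianReal 0 1).real (Set.Iic x) := by
  rw [measureReal_def, gaussianReal_apply_eq_integral 0 one_ne_zero,
    ENNReal.toReal_ofReal (integral_nonneg fun y => gaussianPDFReal_nonneg 0 1 y), gaussErf,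
    ← integral_const_mul]
  simp [gaussianPDFReal]

theorem poissonMeasure_real_range (r : ℝ≥0) (n : ℕ) :
    (poissonMeasure r).real (Finset.range n : Set ℕ) =
      Real.exp (-r) * ∑ j ∈ Finset.range n, (r : ℝ) ^ j / (j.factorial : ℝ) := by
  rw [← sum_measureReal_singleton, Finset.mul_sum]
  refine Finset.sum_congr rfl fun j _ => ?_
  rw [poissonMeasure_real_singleton, mul_div_assoc]

theorem tendsto_sq_mul_cexp_sub_one_sub {ι : Type*} {l : Filter ι} {s : ι → ℝ}
    (hs : Tendsto s l atTop) (t : ℝ) :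
    Tendsto (fun i => (s i : ℂ) ^ 2 * (Complex.exp ((s i : ℂ)⁻¹ * t * Complex.I) - 1 -
      (s i : ℂ)⁻¹ * t * Complex.I)) l (𝓝 (-(t : ℂ) ^ 2 / 2)) := by
  have hz : Tendsto (fun i => ((s i : ℂ))⁻¹ * t * Complex.I) l (𝓝 0) := by
    have h : Tendsto (fun i => (((s i)⁻¹ : ℝ) : ℂ)) l (𝓝 ((0 : ℝ) : ℂ)) :=
      (Complex.continuous_ofReal.tendsto 0).comp (tendsto_inv_atTop_zero.comp hs)
    simpa using (h.mul_const (t : ℂ)).mul_const Complex.I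
  have h1 := (Complex.exp_sub_sum_range_succ_isLittleO_pow 2).comp_tendsto hz
  have h2 : ((fun z : ℂ => z ^ 2) ∘ fun i => ((s i : ℂ))⁻¹ * t * Complex.I) =O[l]
      fun i => ((s i : ℂ) ^ 2)⁻¹ := by
    refine Asymptotics.IsBigO.of_bound (t ^ 2) (Eventually.of_forall fun i => ?_)
    simp [mul_pow, mul_comm]
  have h3 := (h1.trans_isBigO h2).tendsto_div_nhds_zero
  have h4 := h3.add_const (-(t : ℂ) ^ 2 / 2)
  rw [zero_add] at h4
  refine h4.congr' ?_
  filter_upwards [hs.eventually_gt_atTop 0] with i hi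
  have hi' : (s i : ℂ) ≠ 0 := by exact_mod_cast hi.ne'
  simp only [Function.comp_apply, Finset.sum_range_succ, Finset.sum_range_zero, div_inv_eq_mul,
    Nat.factorial, mul_pow, Complex.I_sq]
  push_cast
  field_simp
  ring

/-- The normalization `(X - s²) / s - a` of a Poisson variable `X` of rate `r`. -/
noncomputable def shiftedPoisson (r : ℝ≥0) (s a : ℝ) : ProbabilityMeasure ℝ :=
  ⟨(((poissonMeasure r).map (Nat.cast : ℕ → ℝ)).map (s⁻¹ * ·)).map (· + (-(s + a))), by
    have : IsProbabilityMeasure ((poissonMeasure r).map (Nat.cast : ℕ → ℝ)) :=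
      Measure.isProbabilityMeasure_map .of_discrete
    have : IsProbabilityMeasure (((poissonMeasure r).map (Nat.cast : ℕ → ℝ)).map (s⁻¹ * ·)) :=
      Measure.isProbabilityMeasure_map (by fun_prop)
    exact Measure.isProbabilityMeasure_map (by fun_prop)⟩

theorem charFun_shiftedPoisson (r : ℝ≥0) (s a t : ℝ) :
    charFun (shiftedPoisson r s a : Measure ℝ) t =
      Complex.exp (r * (Complex.exp ((s : ℂ)⁻¹ * t * Complex.I) - 1) - (s + a) * t * Complex.I) := by
  rw [shiftedPoisson, ProbabilityMeasure.coe_mk, charFun_map_add_const, charFun_map_mul,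
    charFun_map_cast_poissonMeasure, ← Complex.exp_add]
  congr 1
  simp
  ring

theorem shiftedPoisson_real_Iic (r : ℝ≥0) {s : ℝ} (hs : 0 < s) (a : ℝ) :
    (shiftedPoisson r s a : Measure ℝ).real (Set.Iic (-a)) =
      Real.exp (-r) * ∑ j ∈ Finset.range (⌊s ^ 2⌋₊ + 1), (r : ℝ) ^ j / (j.factorial : ℝ) := by
  rw [← poissonMeasure_real_range, shiftedPoisson, ProbabilityMeasure.coe_mk, measureReal_def,
    measureReal_def, Measure.map_apply (by fun_prop) measurableSet_Iic,
    Measure.map_apply (by fun_prop) (measurableSet_Iic.preimage (by fun_prop)),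
    Measure.map_apply .of_discrete
      ((measurableSet_Iic.preimage (by fun_prop)).preimage (by fun_prop))]
  congr 2
  ext n
  simp only [Set.mem_preimage, Set.mem_Iic, Finset.coe_range, Set.mem_Iio, Nat.lt_succ_iff,
    Nat.le_floor_iff (sq_nonneg s)]
  rw [show s⁻¹ * (n : ℝ) + -(s + a) ≤ -a ↔ s⁻¹ * n ≤ s by constructor <;> intro <;> linarith,
    inv_mul_le_iff₀ hs, sq]

/-- Central limit theorem for Poisson variables of rate `s² + a s` as `s → ∞`. -/
theorem tendsto_shiftedPoisson {s : ℕ → ℝ} (hs : Tendsto s atTop atTop) (a : ℝ) :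
    Tendsto (fun k => shiftedPoisson (s k ^ 2 + a * s k).toNNReal (s k) a) atTop
      (𝓝 ⟨gaussianReal 0 1, inferInstance⟩) := by
  refine ProbabilityMeasure.tendsto_iff_tendsto_charFun.2 fun t => ?_
  simp only [charFun_shiftedPoisson, ProbabilityMeasure.coe_mk, charFun_gaussianReal]
  refine (Complex.continuous_exp.tendsto _).comp ?_
  have hinv : Tendsto (fun k => (1 : ℂ) + a * (s k : ℂ)⁻¹) atTop (𝓝 1) := by
    have h : Tendsto (fun k => (((s k)⁻¹ : ℝ) : ℂ)) atTop (𝓝 ((0 : ℝ) : ℂ)) :=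
      (Complex.continuous_ofReal.tendsto 0).comp (tendsto_inv_atTop_zero.comp hs)
    simpa using (h.const_mul (a : ℂ)).const_add 1
  have h := hinv.mul (tendsto_sq_mul_cexp_sub_one_sub hs t)
  have hlim : (1 : ℂ) * (-(t : ℂ) ^ 2 / 2) =
      t * (0 : ℝ) * Complex.I - ((1 : ℝ≥0) : ℝ) * t ^ 2 / 2 := by
    push_cast
    ring
  rw [hlim] at h
  refine h.congr' ?_
  filter_upwards [hs.eventually_gt_atTop 0, hs.eventually_gt_atTop (-a)] with k hk hka
  have hk' : (s k : ℂ) ≠ 0 := by exact_mod_cast hk.ne'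
  have hpos : 0 ≤ s k ^ 2 + a * s k := by nlinarith
  rw [Real.coe_toNNReal _ hpos]
  push_cast
  generalize Complex.exp _ = E
  field_simp

/-- Boundary behavior of the partial Bergman density in the Bargmann–Fock model:
for `r_k = ε(1 + u k^{−1/2})` (points with `|z_k|² = ε(1 + u/√k)`),
`e^{−k r_k} Σ_{j=0}^{⌊εk⌋} (k r_k)^j/j! → Φ(−u√ε)`. -/
theorem bargmannFock_boundary_erf (ε u : ℝ) (hε : 0 < ε) :
    Tendsto (fun k : ℕ =>
      Real.exp (-((k : ℝ) * (ε * (1 + u / Real.sqrt (k : ℝ))))) *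
        ∑ j ∈ Finset.range (Nat.floor (ε * (k : ℝ)) + 1),
          ((k : ℝ) * (ε * (1 + u / Real.sqrt (k : ℝ)))) ^ j / (j.factorial : ℝ))
      atTop (nhds (gaussErf (-u * Real.sqrt ε))) := by
  set s : ℕ → ℝ := fun k => Real.sqrt (ε * k)
  have hs : Tendsto s atTop atTop :=
    Real.tendsto_sqrt_atTop.comp (tendsto_natCast_atTop_atTop.const_mul_atTop hε)
  have hlim := ProbabilityMeasure.tendsto_measure_of_null_frontier_of_tendsto'
    (tendsto_shiftedPoisson hs (u * Real.sqrt ε)) (E := Set.Iic (-(u * Real.sqrt ε)))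
    (by
      have := nullSingletonClass_gaussianReal (μ := 0) (v := 1) one_ne_zero
      simp)
  have hreal := (ENNReal.tendsto_toReal (measure_ne_top (gaussianReal 0 1) _)).comp hlim
  rw [neg_mul, gaussErf_eq_gaussianReal]
  refine hreal.congr' ?_
  filter_upwards [hs.eventually_gt_atTop 0, hs.eventually_gt_atTop (-(u * Real.sqrt ε)),
    eventually_gt_atTop 0] with k hk hku hk0
  have hk0' : (0 : ℝ) < k := by exact_mod_cast hk0
  have hsq : s k ^ 2 = ε * k := Real.sq_sqrt (by positivity)
  have hrate : s k ^ 2 + u * Real.sqrt ε * s k = k * (ε * (1 + u / Real.sqrt k)) := by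
    have h1 : s k = Real.sqrt ε * Real.sqrt k := Real.sqrt_mul hε.le _
    have h2 : Real.sqrt ε ^ 2 = ε := Real.sq_sqrt hε.le
    have h4 : (k : ℝ) / Real.sqrt k = Real.sqrt k := Real.div_sqrt
    rw [hsq, h1]
    linear_combination u * Real.sqrt k * h2 - ε * u * h4
  have hpos : 0 ≤ s k ^ 2 + u * Real.sqrt ε * s k := by nlinarith
  have h := shiftedPoisson_real_Iic (s k ^ 2 + u * Real.sqrt ε * s k).toNNReal hk
    (u * Real.sqrt ε)
  rw [Real.coe_toNNReal _ hpos, hrate, hsq] at h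
  rw [← h, ← hrate]
  simp [measureReal_def, hsq]
end

section
/- Let m ≥ 1 and α ∈ ℂ^m. Define the vector field V on ℂ^m × ℝ by V(z, θ) = ( −iα/2, −(1/2) Re( Σ_{j=1}^m α_j \overline{z_j} ) ). Then for every (z, θ) ∈ ℂ^m × ℝ, the curve γ(t) = ( z − iαt/2, θ − (t/2) Re( Σ_j α_j \overline{z_j} ) ) satisfies γ(0) = (z, θ) and γ′(t) = V(γ(t)) for all t ∈ ℝ; moreover γ(t) = (−iαt/2, 0) ∘ (z, θ), where ∘ denotes the reduced Heisenberg product (w, s) ∘ (z, θ) = (w + z, s + θ + Im(w·z̄)). -/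
open ComplexConjugate

/-- The reduced Heisenberg product `(w, s) ∘ (z, θ) = (w + z, s + θ + Im(w·z̄))`. -/
noncomputable def heisMul (m : ℕ) (p q : (Fin m → ℂ) × ℝ) : (Fin m → ℂ) × ℝ :=
  (fun j => p.1 j + q.1 j, p.2 + q.2 + (dotc p.1 q.1).im)

/-- The contact lift of the Hamiltonian vector field of the linear Hamiltonian
`H(z) = Re(Σ_j α_j z̄_j)`: `V(z, θ) = (−iα/2, −(1/2) Re(Σ_j α_j z̄_j))`. -/
noncomputable def heisVField (m : ℕ) (α : Fin m → ℂ) (p : (Fin m → ℂ) × ℝ) :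
    (Fin m → ℂ) × ℝ :=
  (fun j => -(Complex.I * α j) / 2, -(1 / 2) * (dotc α p.1).re)

theorem dotc_smul_left {m : ℕ} (c : ℂ) (z w : Fin m → ℂ) : dotc (c • z) w = c * dotc z w := by
  simp [dotc, Finset.mul_sum, mul_assoc]

theorem dotc_smul_right {m : ℕ} (c : ℂ) (z w : Fin m → ℂ) :
    dotc z (c • w) = conj c * dotc z w := by
  simp [dotc, Finset.mul_sum, mul_left_comm]

theorem dotc_sub_right {m : ℕ} (z w w' : Fin m → ℂ) :
    dotc z (w - w') = dotc z w - dotc z w' := by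
  simp [dotc, mul_sub]

theorem dotc_self_im {m : ℕ} (z : Fin m → ℂ) : (dotc z z).im = 0 := by
  simp [dotc, Complex.mul_conj]

/-- A linear Hamiltonian is constant along its own Hamiltonian flow. -/
theorem re_dotc_linear_flow {m : ℕ} (α z : Fin m → ℂ) (t : ℝ) :
    (dotc α (fun j => z j - Complex.I * α j * (t : ℂ) / 2)).re = (dotc α z).re := by
  have h : (fun j => z j - Complex.I * α j * (t : ℂ) / 2)
      = z - (((t / 2 : ℝ) : ℂ) * Complex.I) • α := by
    ext j
    simp only [Pi.sub_apply, Pi.smul_apply, smul_eq_mul]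
    push_cast
    ring
  rw [h, dotc_sub_right, dotc_smul_right, map_mul, Complex.conj_ofReal, Complex.conj_I, mul_assoc,
    Complex.sub_re, Complex.re_ofReal_mul]
  simp [dotc_self_im]

theorem im_dotc_linear_flow {m : ℕ} (α z : Fin m → ℂ) (t : ℝ) :
    (dotc (fun j => -(Complex.I * α j * (t : ℂ)) / 2) z).im = -(t / 2 * (dotc α z).re) := by
  have h : (fun j => -(Complex.I * α j * (t : ℂ)) / 2)
      = (((-(t / 2) : ℝ) : ℂ) * Complex.I) • α := by
    ext j
    simp only [Pi.smul_apply, smul_eq_mul]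
    push_cast
    ring
  rw [h, dotc_smul_left, mul_assoc, Complex.im_ofReal_mul, Complex.I_mul_im, neg_mul]

/-- The lifted contact flow of a linear Hamiltonian in the Bargmann–Fock model:
the curve `γ(t) = (z − iαt/2, θ − (t/2) Re(Σ_j α_j z̄_j))` is the integral curve of
the contact lift `V` through `(z, θ)`, and it equals left Heisenberg multiplication
by `(−iαt/2, 0)`. -/
theorem heisenberg_linear_flow (m : ℕ) (hm : 1 ≤ m) (α z : Fin m → ℂ) (θ : ℝ) :
    letI γ : ℝ → (Fin m → ℂ) × ℝ := fun t =>
      (fun j => z j - Complex.I * α j * (t : ℂ) / 2, θ - t / 2 * (dotc α z).re)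
    γ 0 = (z, θ) ∧
    (∀ t : ℝ, HasDerivAt γ (heisVField m α (γ t)) t) ∧
    (∀ t : ℝ, γ t = heisMul m (fun j => -(Complex.I * α j * (t : ℂ)) / 2, 0) (z, θ)) := by
  refine ⟨by simp, fun t => HasDerivAt.prodMk (hasDerivAt_pi.2 fun j => ?_) ?_, fun t => ?_⟩
  · refine ((((hasDerivAt_id' t).ofReal_comp.const_mul (Complex.I * α j)).div_const 2).const_sub
      (z j)).congr_deriv ?_
    rw [Complex.ofReal_one, mul_one, neg_div]
  · rw [re_dotc_linear_flow]
    refine ((((hasDerivAt_id' t).div_const 2).mul_const (dotc α z).re).const_sub θ).congr_deriv ?_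
    ring
  · simp only [heisMul, im_dotc_linear_flow]
    ext j <;> ring
end
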